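/- arXiv:2002.01691 — 2 statements merged into one kernel-verified Lean document; each statement's English description precedes it below -/
import Mathlib

section
/- Let ρ ∈ L¹₊(Ω) with ρ > 0, let φ : Ω → ℝ₊ be bounded, suppose ∇W ⋆ ρ ∈ L^∞(Ω), and let u be a bounded velocity field satisfying the implicit relation γ u(x) = −(∇W ⋆ ρ)(x) + (φ ⋆ (ρu))(x) − u(x)(φ ⋆ ρ)(x) for all x ∈ Ω. If γ > ‖φ‖_{L^∞}‖ρ‖_{L¹}, then ‖u‖_{L^∞} ≤ ‖∇W ⋆ ρ‖_{L^∞} / ( γ − ‖φ‖_{L^∞}‖ρ‖_{L¹} ). -/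
open MeasureTheory Real Filter Set Function
open scoped ENNReal Topology RealInnerProductSpace

noncomputable section

/-- `ℝ^d`; in the paper the domain `Ω` is `𝕋^d` or `ℝ^d`, we work on `ℝ^d`. -/
abbrev Euc (d : ℕ) := EuclideanSpace ℝ (Fin d)

/-- The measure on `ℝ^d` with density `f` with respect to Lebesgue measure. -/
def mdens {d : ℕ} (f : Euc d → ℝ) : Measure (Euc d) :=
  volume.withDensity fun x => ENNReal.ofReal (f x)

/-- `γ` is a coupling of `μ` and `ν`, i.e. has first and second marginals `μ` and `ν`. -/
def IsCoupling {d : ℕ} (γ : Measure (Euc d × Euc d)) (μ ν : Measure (Euc d)) : Prop :=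
  γ.map Prod.fst = μ ∧ γ.map Prod.snd = ν

/-- The `p`-Wasserstein distance `d_p(μ,ν) = inf_{γ ∈ Γ(μ,ν)} (∬ |x-y|^p dγ)^{1/p}`. -/
def Wp {d : ℕ} (p : ℝ) (μ ν : Measure (Euc d)) : ℝ :=
  sInf { c | ∃ γ : Measure (Euc d × Euc d), IsProbabilityMeasure γ ∧ IsCoupling γ μ ν ∧
    c = (∫ z, dist z.1 z.2 ^ p ∂γ) ^ (1 / p) }

/-- The `∞`-Wasserstein distance `d_∞(μ,ν) = inf_{γ ∈ Γ(μ,ν)} esssup_{supp γ} |x-y|`. -/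
def Winf {d : ℕ} (μ ν : Measure (Euc d)) : ℝ :=
  sInf { c | ∃ γ : Measure (Euc d × Euc d), IsProbabilityMeasure γ ∧ IsCoupling γ μ ν ∧
    ∀ᵐ z ∂γ, dist z.1 z.2 ≤ c }

/-- The convolution `(∇W ⋆ f)(x) = ∫ f(y) ∇W(x-y) dy`. -/
def gradConv {d : ℕ} (W : Euc d → ℝ) (f : Euc d → ℝ) (x : Euc d) : Euc d :=
  ∫ y, f y • gradient W (x - y)

/-- The nonlocal alignment force `∫ φ(x-y)(v(y)-v(x)) f(y) dy`. -/
def alignForce {d : ℕ} (φ : Euc d → ℝ) (f : Euc d → ℝ) (v : Euc d → Euc d) (x : Euc d) :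
    Euc d :=
  ∫ y, (φ (x - y) * f y) • (v y - v x)

/-- The Laplacian `Δ f = ∑ᵢ ∂²f/∂xᵢ²`. -/
def lap {d : ℕ} (f : Euc d → ℝ) (x : Euc d) : ℝ :=
  ∑ i : Fin d, fderiv ℝ (fun y => fderiv ℝ f y (EuclideanSpace.single i 1)) x
    (EuclideanSpace.single i 1)

/-- `W` is a fundamental solution of Laplace's equation, `-ΔW = δ₀`, in the sense of
distributions. -/
def IsCoulomb {d : ℕ} (W : Euc d → ℝ) : Prop :=
  ∀ f : Euc d → ℝ, ContDiff ℝ (⊤ : ℕ∞) f → HasCompactSupport f → -(∫ x, W x * lap f x) = f 0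

/-- A curve of measures is narrowly continuous on `s` if it is continuous in duality with
bounded continuous functions. -/
def NarrowlyContinuousOn {d : ℕ} (μ : ℝ → Measure (Euc d)) (s : Set ℝ) : Prop :=
  ∀ f : Euc d → ℝ, Continuous f → (∃ K, ∀ x, |f x| ≤ K) →
    ContinuousOn (fun t => ∫ x, f x ∂(μ t)) s

/-- The measure-valued curve `μ` solves `∂ₜ μ + ∇·(μ v) = 0` on `(0,T)` in the sense of
distributions. -/
def SolvesContinuityEq {d : ℕ} (T : ℝ) (μ : ℝ → Measure (Euc d))
    (v : ℝ → Euc d → Euc d) : Prop :=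
  ∀ χ : ℝ → Euc d → ℝ, ContDiff ℝ (⊤ : ℕ∞) (uncurry χ) →
    HasCompactSupport (uncurry χ) → (∀ t ∉ Ioo (0:ℝ) T, ∀ x, χ t x = 0) →
    (∫ t in Ioo (0:ℝ) T, ∫ x, (deriv (fun s => χ s x) t + ⟪gradient (χ t) x, v t x⟫)
      ∂(μ t)) = 0

/-- The density `ρ` solves `∂ₜ ρ + ∇·(ρ v) = 0` on `(0,T)` in the sense of distributions. -/
def SolvesContinuityEqFun {d : ℕ} (T : ℝ) (ρ : ℝ → Euc d → ℝ)
    (v : ℝ → Euc d → Euc d) : Prop :=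
  ∀ χ : ℝ → Euc d → ℝ, ContDiff ℝ (⊤ : ℕ∞) (uncurry χ) →
    HasCompactSupport (uncurry χ) → (∀ t ∉ Ioo (0:ℝ) T, ∀ x, χ t x = 0) →
    (∫ t in Ioo (0:ℝ) T, ∫ x,
      (deriv (fun s => χ s x) t * ρ t x + ⟪gradient (χ t) x, ρ t x • v t x⟫)) = 0

/-- Weak solution `(ρ, ρu)` of the pressureless Euler system with nonlocal forces
`∂ₜρ + ∇·(ρu) = 0`,
`ε∂ₜ(ρu) + ε∇·(ρu⊗u) = -γρu - (∇W⋆ρ)ρ + ρ ∫ φ(x-y)(u(y)-u(x))ρ(y) dy`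
in the sense of Definition 2.1: `ρ ∈ C([0,T); L¹₊)`, `ρ|u|² ∈ C([0,T); L¹)`, the system holds
in the sense of distributions, and the weak formulation of the energy equality holds. -/
structure IsWeakSolutionEuler {d : ℕ} (T ε γ : ℝ) (W φ : Euc d → ℝ)
    (ρ : ℝ → Euc d → ℝ) (u : ℝ → Euc d → Euc d) : Prop where
  nonneg : ∀ t x, 0 ≤ ρ t x
  rho_int : ∀ t ∈ Ico (0:ℝ) T, Integrable (ρ t)
  kin_int : ∀ t ∈ Ico (0:ℝ) T, Integrable fun x => ρ t x * ‖u t x‖ ^ 2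
  rho_L1_cont : ∀ s ∈ Ico (0:ℝ) T,
    Tendsto (fun t => ∫ x, |ρ t x - ρ s x|) (𝓝[Ico (0:ℝ) T] s) (𝓝 0)
  kin_L1_cont : ∀ s ∈ Ico (0:ℝ) T,
    Tendsto (fun t => ∫ x, |ρ t x * ‖u t x‖ ^ 2 - ρ s x * ‖u s x‖ ^ 2|)
      (𝓝[Ico (0:ℝ) T] s) (𝓝 0)
  continuity_eq : ∀ χ : ℝ → Euc d → ℝ, ContDiff ℝ (⊤ : ℕ∞) (uncurry χ) →
    HasCompactSupport (uncurry χ) → (∀ t ∉ Ioo (0:ℝ) T, ∀ x, χ t x = 0) →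
    (∫ t in Ioo (0:ℝ) T, ∫ x,
      (deriv (fun s => χ s x) t * ρ t x + ⟪gradient (χ t) x, ρ t x • u t x⟫)) = 0
  momentum_eq : ∀ Φ : ℝ → Euc d → Euc d, ContDiff ℝ (⊤ : ℕ∞) (uncurry Φ) →
    HasCompactSupport (uncurry Φ) → (∀ t ∉ Ioo (0:ℝ) T, ∀ x, Φ t x = 0) →
    (∫ t in Ioo (0:ℝ) T, ∫ x,
      (ε * ⟪deriv (fun s => Φ s x) t, ρ t x • u t x⟫
        + ε * (ρ t x * ⟪(fderiv ℝ (Φ t) x) (u t x), u t x⟫)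
        + ⟪Φ t x, (-γ) • (ρ t x • u t x) - ρ t x • gradConv W (ρ t) x
            + ρ t x • alignForce φ (ρ t) (u t) x⟫)) = 0
  energy_eq : ∀ ψ : ℝ → ℝ, ContinuousOn ψ (Icc 0 T) →
    (∃ L : NNReal, LipschitzOnWith L ψ (Icc 0 T)) → (∀ t, 0 ≤ ψ t) → ψ T = 0 →
    -(ε / 2) * (∫ t in Ioo (0:ℝ) T, (∫ x, ρ t x * ‖u t x‖ ^ 2) * deriv ψ t)
        + γ * (∫ t in Ioo (0:ℝ) T, (∫ x, ρ t x * ‖u t x‖ ^ 2) * ψ t)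
        + (1 / 2) * (∫ t in Ioo (0:ℝ) T,
            (∫ x, ∫ y, φ (x - y) * ‖u t x - u t y‖ ^ 2 * ρ t x * ρ t y) * ψ t)
      = (ε / 2) * (∫ x, ρ 0 x * ‖u 0 x‖ ^ 2) * ψ 0
        - ∫ t in Ioo (0:ℝ) T, (∫ x, ⟪gradConv W (ρ t) x, ρ t x • u t x⟫) * ψ t

/-- Strong solution `(ρ, u)` of the aggregation equation `∂ₜρ + ∇·(ρu) = 0` with
`γρu = -ρ(∇W⋆ρ) + ρ∫ φ(x-y)(u(y)-u(x))ρ(y) dy`, in the sense of Definition 2.3: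
`ρ ∈ C([0,T); (L¹₊ ∩ 𝒫_p))`, `u ∈ L^∞(0,T; W^{1,∞})`, `∂ₜu ∈ L^∞`, and the equation holds
in the sense of distributions. -/
structure IsStrongSolutionAgg {d : ℕ} (T γ p : ℝ) (W φ : Euc d → ℝ)
    (ρ : ℝ → Euc d → ℝ) (u : ℝ → Euc d → Euc d) : Prop where
  nonneg : ∀ t x, 0 ≤ ρ t x
  prob : ∀ t ∈ Ico (0:ℝ) T, IsProbabilityMeasure (mdens (ρ t))
  momentp : ∀ t ∈ Ico (0:ℝ) T, Integrable fun x => ρ t x * ‖x‖ ^ p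
  rho_L1_cont : ∀ s ∈ Ico (0:ℝ) T,
    Tendsto (fun t => ∫ x, |ρ t x - ρ s x|) (𝓝[Ico (0:ℝ) T] s) (𝓝 0)
  u_W1inf : ∃ M : ℝ, ∀ t ∈ Ico (0:ℝ) T,
    (∀ x, ‖u t x‖ ≤ M) ∧ LipschitzWith (Real.toNNReal M) (u t)
  ut_bdd : ∃ M : ℝ, ∀ x, ∀ t ∈ Ioo (0:ℝ) T,
    DifferentiableAt ℝ (fun s => u s x) t ∧ ‖deriv (fun s => u s x) t‖ ≤ M
  continuity_eq : ∀ χ : ℝ → Euc d → ℝ, ContDiff ℝ (⊤ : ℕ∞) (uncurry χ) →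
    HasCompactSupport (uncurry χ) → (∀ t ∉ Ioo (0:ℝ) T, ∀ x, χ t x = 0) →
    (∫ t in Ioo (0:ℝ) T, ∫ x,
      (deriv (fun s => χ s x) t * ρ t x + ⟪gradient (χ t) x, ρ t x • u t x⟫)) = 0
  velocity : ∀ t ∈ Ico (0:ℝ) T, ∀ x,
    γ • (ρ t x • u t x)
      = -(ρ t x • gradConv W (ρ t) x) + ρ t x • alignForce φ (ρ t) (u t) x

/-- Appendix A, estimate of `‖u‖_{L^∞}`: if `γu = -∇W⋆ρ + φ⋆(ρu) - u(φ⋆ρ)` and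
`γ > ‖φ‖_{L^∞}‖ρ‖_{L¹}`, then `‖u‖_{L^∞} ≤ ‖∇W⋆ρ‖_{L^∞}/(γ - ‖φ‖_{L^∞}‖ρ‖_{L¹})`. -/
theorem velocity_Linfty_bound (d : ℕ) (hd : 1 ≤ d) (γ : ℝ) (W φ : Euc d → ℝ)
    (ρ : Euc d → ℝ) (u : Euc d → Euc d)
    (hρpos : ∀ x, 0 < ρ x) (hρint : Integrable ρ)
    (Kφ KW Mρ Mu : ℝ)
    (hφnn : ∀ x, 0 ≤ φ x) (hφb : ∀ x, φ x ≤ Kφ)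
    -- `‖∇W ⋆ ρ‖_{L^∞} ≤ KW`:
    (hWb : ∀ x, ‖gradConv W ρ x‖ ≤ KW)
    -- `‖ρ‖_{L¹} = Mρ`:
    (hmass : ∫ x, ρ x = Mρ)
    -- `u` bounded:
    (hub : ∀ x, ‖u x‖ ≤ Mu)
    -- the velocity relation `γu = -∇W⋆ρ + φ⋆(ρu) - u (φ⋆ρ)`:
    (heq : ∀ x, γ • u x = -gradConv W ρ x + (∫ y, (φ (x - y) * ρ y) • u y)
      - (∫ y, φ (x - y) * ρ y) • u x)
    (hγ : Kφ * Mρ < γ) :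
    ∀ x, ‖u x‖ ≤ KW / (γ - Kφ * Mρ) := by
  have hγK : 0 < γ - Kφ * Mρ := sub_pos.mpr hγ
  have hKφ : 0 ≤ Kφ := (hφnn 0).trans (hφb 0)
  have hMρ : 0 ≤ Mρ := hmass ▸ integral_nonneg fun x => (hρpos x).le
  have hγpos : 0 < γ := (mul_nonneg hKφ hMρ).trans_lt hγ
  have hbdd : BddAbove (range fun x => ‖u x‖) := ⟨Mu, by rintro _ ⟨x, rfl⟩; exact hub x⟩
  set S := ⨆ x, ‖u x‖
  have huS : ∀ x, ‖u x‖ ≤ S := fun x => le_ciSup hbdd x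
  have hconv : ∀ x, ‖∫ y, (φ (x - y) * ρ y) • u y‖ ≤ Kφ * Mρ * S := by
    intro x
    calc ‖∫ y, (φ (x - y) * ρ y) • u y‖ ≤ ∫ y, Kφ * ρ y * S := by
          refine norm_integral_le_of_norm_le ((hρint.const_mul Kφ).mul_const S)
            (Eventually.of_forall fun y => ?_)
          have h0 : 0 ≤ φ (x - y) * ρ y := mul_nonneg (hφnn _) (hρpos y).le
          rw [norm_smul, Real.norm_of_nonneg h0]
          exact mul_le_mul (mul_le_mul_of_nonneg_right (hφb _) (hρpos y).le) (huS y)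
            (norm_nonneg _) (mul_nonneg hKφ (hρpos y).le)
      _ = Kφ * Mρ * S := by rw [integral_mul_const, integral_const_mul, hmass]
  have hpt : ∀ x, γ * ‖u x‖ ≤ KW + Kφ * Mρ * S := by
    intro x
    have ha : 0 ≤ ∫ y, φ (x - y) * ρ y :=
      integral_nonneg fun y => mul_nonneg (hφnn _) (hρpos y).le
    have hsum : (γ + ∫ y, φ (x - y) * ρ y) • u x
        = -gradConv W ρ x + ∫ y, (φ (x - y) * ρ y) • u y := by
      rw [add_smul, heq x, sub_add_cancel]
    calc γ * ‖u x‖ ≤ (γ + ∫ y, φ (x - y) * ρ y) * ‖u x‖ :=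
          mul_le_mul_of_nonneg_right (le_add_of_nonneg_right ha) (norm_nonneg _)
      _ = ‖-gradConv W ρ x + ∫ y, (φ (x - y) * ρ y) • u y‖ := by
          rw [← hsum, norm_smul, Real.norm_of_nonneg (add_nonneg hγpos.le ha)]
      _ ≤ KW + Kφ * Mρ * S := by
          refine (norm_add_le _ _).trans (add_le_add ?_ (hconv x))
          rw [norm_neg]
          exact hWb x
  have hSle : S ≤ (KW + Kφ * Mρ * S) / γ :=
    ciSup_le fun x => (le_div_iff₀' hγpos).mpr (hpt x)
  rw [le_div_iff₀' hγpos] at hSle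
  intro x
  refine (huS x).trans ((le_div_iff₀ hγK).mpr ?_)
  linarith
end
end

section
/- Let ρ ∈ L¹₊(Ω) with ρ > 0, φ ∈ W^{1,∞}(Ω) nonnegative, suppose ∇W ⋆ ρ ∈ W^{1,∞}(Ω), and let u ∈ W^{1,∞}(Ω) satisfy γ u = −∇W ⋆ ρ + φ ⋆ (ρu) − u(φ ⋆ ρ) with γ > ‖φ‖_{L^∞}‖ρ‖_{L¹}. Then ‖∇u‖_{L^∞} ≤ ( 1 + ‖∇φ‖_{L^∞}‖ρ‖_{L¹}/γ ) · (1/γ) · ( ‖∇W ⋆ ρ‖_{W^{1,∞}} + ‖ρ‖_{L¹}‖φ‖_{W^{1,∞}} ‖∇W ⋆ ρ‖_{L^∞} / ( γ − ‖φ‖_{L^∞}‖ρ‖_{L¹} ) ). In particular, ‖u‖_{W^{1,∞}} is bounded by a constant depending only on ‖∇W ⋆ ρ‖_{W^{1,∞}}, ‖φ‖_{W^{1,∞}}, ‖ρ‖_{L¹}, and γ. -/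
open MeasureTheory Real Filter Set Function
open scoped ENNReal Topology RealInnerProductSpace

noncomputable section

/-- A continuous field bounded by `A`, weighted by a continuous kernel bounded by `C` and an
integrable density, is integrable. -/
theorem integrable_kernel_smul {d : ℕ} {E : Type*} [NormedAddCommGroup E] [NormedSpace ℝ E]
    {ρ g : Euc d → ℝ} {v : Euc d → E} {C A : ℝ} (hρ : Integrable ρ)
    (hg : Continuous g) (hgC : ∀ y, |g y| ≤ C) (hv : Continuous v) (hvA : ∀ y, ‖v y‖ ≤ A) :
    Integrable fun y => (g y * ρ y) • v y :=
  (hρ.bdd_mul hg.aestronglyMeasurable (ae_of_all _ hgC)).smul_bdd A hv.aestronglyMeasurable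
    (ae_of_all _ hvA)

/-- The `L¹`–`L^∞` bound for a kernel integrated against a nonnegative density. -/
theorem norm_integral_kernel_smul_le {d : ℕ} {E : Type*} [NormedAddCommGroup E]
    [NormedSpace ℝ E] {ρ g : Euc d → ℝ} {v : Euc d → E} {C A : ℝ} (hρ : Integrable ρ)
    (hρnn : ∀ y, 0 ≤ ρ y) (hgC : ∀ y, |g y| ≤ C) (hvA : ∀ y, ‖v y‖ ≤ A) :
    ‖∫ y, (g y * ρ y) • v y‖ ≤ C * A * ∫ y, ρ y := by
  rw [← integral_const_mul]
  refine norm_integral_le_of_norm_le (hρ.const_mul _) (ae_of_all _ fun y => ?_)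
  have hC : 0 ≤ C := (abs_nonneg _).trans (hgC y)
  rw [norm_smul, norm_mul, Real.norm_eq_abs, Real.norm_of_nonneg (hρnn y), mul_right_comm]
  gcongr
  · exact hρnn y
  · exact hgC y
  · exact hvA y

/-- A bounded family satisfying `γ ‖u x‖ ≤ K + b S` for each of its upper bounds `S ≥ 0`
is bounded by `K / (γ - b)`. -/
theorem norm_le_div_of_self_bound {X E : Type*} [NormedAddCommGroup E] {u : X → E}
    {γ K b M : ℝ} (hM : ∀ x, ‖u x‖ ≤ M) (hγ : 0 < γ) (hb : b < γ)
    (h : ∀ S, (∀ x, ‖u x‖ ≤ S) → ∀ x, γ * ‖u x‖ ≤ K + b * S) (x : X) :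
    ‖u x‖ ≤ K / (γ - b) := by
  have : Nonempty X := ⟨x⟩
  have hbdd : BddAbove (range fun x => ‖u x‖) := ⟨M, by rintro _ ⟨y, rfl⟩; exact hM y⟩
  set S := ⨆ y, ‖u y‖ with hS
  have hle : ∀ y, ‖u y‖ ≤ S := le_ciSup hbdd
  have hSle : S ≤ (K + b * S) / γ := ciSup_le fun y => by
    rw [le_div_iff₀ hγ, mul_comm]
    exact h S hle y
  rw [le_div_iff₀ hγ] at hSle
  refine (hle x).trans ?_
  rw [le_div_iff₀ (sub_pos.2 hb)]
  linarith

/-- Appendix A, estimate of `‖∇u‖_{L^∞}` (and of `‖u‖_{W^{1,∞}}`). Here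
`KW₀, KW₁` bound `‖∇W⋆ρ‖_{L^∞}` and its Lipschitz/derivative norm, so
`KW₀ + KW₁` bounds `‖∇W⋆ρ‖_{W^{1,∞}}`; similarly `Kφ₀ + Kφ₁` bounds `‖φ‖_{W^{1,∞}}`. -/
theorem velocity_gradient_bound (d : ℕ) (hd : 1 ≤ d) (γ : ℝ) (W φ : Euc d → ℝ)
    (ρ : Euc d → ℝ) (u : Euc d → Euc d)
    (hρpos : ∀ x, 0 < ρ x) (hρint : Integrable ρ)
    (Kφ₀ Kφ₁ KW₀ KW₁ Mρ Mu : ℝ)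
    (hφnn : ∀ x, 0 ≤ φ x) (hφb : ∀ x, φ x ≤ Kφ₀)
    (hφdiff : Differentiable ℝ φ) (hφ1 : ∀ x, ‖gradient φ x‖ ≤ Kφ₁)
    (hWb : ∀ x, ‖gradConv W ρ x‖ ≤ KW₀)
    (hWdiff : Differentiable ℝ (gradConv W ρ))
    (hW1 : ∀ x, ‖fderiv ℝ (gradConv W ρ) x‖ ≤ KW₁)
    (hmass : ∫ x, ρ x = Mρ)
    (hub : ∀ x, ‖u x‖ ≤ Mu) (hudiff : Differentiable ℝ u)
    (heq : ∀ x, γ • u x = -gradConv W ρ x + (∫ y, (φ (x - y) * ρ y) • u y)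
      - (∫ y, φ (x - y) * ρ y) • u x)
    (hγ : Kφ₀ * Mρ < γ) :
    (∀ x, ‖fderiv ℝ u x‖
        ≤ (1 + Kφ₁ * Mρ / γ) * (1 / γ) *
            ((KW₀ + KW₁) + Mρ * (Kφ₀ + Kφ₁) * KW₀ / (γ - Kφ₀ * Mρ)))
    ∧ ∀ x, ‖u x‖ + ‖fderiv ℝ u x‖
        ≤ KW₀ / (γ - Kφ₀ * Mρ)
          + (1 + Kφ₁ * Mρ / γ) * (1 / γ) *
              ((KW₀ + KW₁) + Mρ * (Kφ₀ + Kφ₁) * KW₀ / (γ - Kφ₀ * Mρ)) := by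
  have hρnn : ∀ y, 0 ≤ ρ y := fun y => (hρpos y).le
  have hM : 0 ≤ Mρ := hmass ▸ integral_nonneg hρnn
  have hφ₀ : 0 ≤ Kφ₀ := (hφnn 0).trans (hφb 0)
  have hφ₁ : 0 ≤ Kφ₁ := (norm_nonneg _).trans (hφ1 0)
  have hW₀ : 0 ≤ KW₀ := (norm_nonneg _).trans (hWb 0)
  have hW₁ : 0 ≤ KW₁ := (norm_nonneg _).trans (hW1 0)
  have hγ0 : 0 < γ := (mul_nonneg hφ₀ hM).trans_lt hγ
  have hφabs : ∀ x, |φ x| ≤ Kφ₀ := fun x => (abs_of_nonneg (hφnn x)).trans_le (hφb x)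
  have hφc : ∀ x, Continuous fun y => φ (x - y) := fun x =>
    hφdiff.continuous.comp (continuous_const.sub continuous_id)
  have hφlip : ∀ x z, |φ x - φ z| ≤ Kφ₁ * ‖x - z‖ := fun x z => by
    refine convex_univ.norm_image_sub_le_of_norm_fderiv_le (𝕜 := ℝ)
      (fun w _ => hφdiff w) (fun w _ => ?_) (mem_univ z) (mem_univ x)
    simpa [gradient] using hφ1 w
  have hWlip : ∀ x z, ‖gradConv W ρ x - gradConv W ρ z‖ ≤ KW₁ * ‖x - z‖ := fun x z =>
    convex_univ.norm_image_sub_le_of_norm_fderiv_le (𝕜 := ℝ)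
      (fun w _ => hWdiff w) (fun w _ => hW1 w) (mem_univ z) (mem_univ x)
  have ha0 : ∀ x, 0 ≤ ∫ y, φ (x - y) * ρ y := fun x =>
    integral_nonneg fun y => mul_nonneg (hφnn _) (hρnn y)
  have hint : ∀ x, Integrable fun y => (φ (x - y) * ρ y) • u y := fun x =>
    integrable_kernel_smul hρint (hφc x) (fun y => hφabs _) hudiff.continuous hub
  have hinta : ∀ x, Integrable fun y => φ (x - y) * ρ y := fun x =>
    hρint.bdd_mul (hφc x).aestronglyMeasurable (ae_of_all _ fun y => hφabs _)
  have hU : ∀ x, ‖u x‖ ≤ KW₀ / (γ - Kφ₀ * Mρ) := by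
    refine norm_le_div_of_self_bound hub hγ0 hγ fun S hS x => ?_
    have hx : (γ + ∫ y, φ (x - y) * ρ y) • u x
        = -gradConv W ρ x + ∫ y, (φ (x - y) * ρ y) • u y := by
      rw [add_smul, heq x]
      abel
    have hI := norm_integral_kernel_smul_le hρint hρnn (fun y => hφabs (x - y)) hS
    rw [hmass] at hI
    calc γ * ‖u x‖ ≤ (γ + ∫ y, φ (x - y) * ρ y) * ‖u x‖ := by
          gcongr
          linarith [ha0 x]
      _ = ‖-gradConv W ρ x + ∫ y, (φ (x - y) * ρ y) • u y‖ := by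
          rw [← hx, norm_smul, Real.norm_of_nonneg (add_nonneg hγ0.le (ha0 x))]
      _ ≤ KW₀ + Kφ₀ * S * Mρ := by
          refine (norm_add_le _ _).trans (add_le_add ?_ hI)
          rw [norm_neg]
          exact hWb x
      _ = KW₀ + Kφ₀ * Mρ * S := by ring
  set U := KW₀ / (γ - Kφ₀ * Mρ) with hUdef
  have hUγ : γ * U = KW₀ + Kφ₀ * Mρ * U := by
    have : U * (γ - Kφ₀ * Mρ) = KW₀ := div_mul_cancel₀ _ (sub_pos.2 hγ).ne'
    linarith
  have hU0 : 0 ≤ U := div_nonneg hW₀ (sub_pos.2 hγ).le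
  have hlip : ∀ x z, γ * ‖u x - u z‖ ≤ (KW₁ + 2 * (Kφ₁ * Mρ * U)) * ‖x - z‖ := fun x z => by
    have hxz : (γ + ∫ y, φ (x - y) * ρ y) • (u x - u z)
        = -(gradConv W ρ x - gradConv W ρ z)
          + ∫ y, ((φ (x - y) - φ (z - y)) * ρ y) • (u y - u z) := by
      have hsplit : ∫ y, ((φ (x - y) - φ (z - y)) * ρ y) • (u y - u z)
          = (∫ y, (φ (x - y) * ρ y) • u y) - (∫ y, (φ (z - y) * ρ y) • u y)
            - ((∫ y, φ (x - y) * ρ y) • u z - (∫ y, φ (z - y) * ρ y) • u z) := by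
        have hu : Integrable fun y => (φ (x - y) * ρ y) • u y - (φ (z - y) * ρ y) • u y :=
          (hint x).sub (hint z)
        have hc : Integrable fun y => (φ (x - y) * ρ y) • u z - (φ (z - y) * ρ y) • u z :=
          ((hinta x).smul_const _).sub ((hinta z).smul_const _)
        rw [← integral_smul_const, ← integral_smul_const, ← integral_sub (hint x) (hint z),
          ← integral_sub ((hinta x).smul_const _) ((hinta z).smul_const _),
          ← integral_sub hu hc]
        refine integral_congr_ae (ae_of_all _ fun y => ?_)
        simp only [sub_mul, sub_smul, smul_sub]
      rw [hsplit, add_smul, smul_sub γ, heq x, heq z, smul_sub]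
      abel
    have hI := norm_integral_kernel_smul_le (g := fun y => φ (x - y) - φ (z - y))
      (v := fun y => u y - u z) (C := Kφ₁ * ‖x - z‖) (A := U + U) hρint hρnn
      (fun y => by simpa using hφlip (x - y) (z - y))
      (fun y => (norm_sub_le _ _).trans (add_le_add (hU y) (hU z)))
    rw [hmass] at hI
    calc γ * ‖u x - u z‖ ≤ (γ + ∫ y, φ (x - y) * ρ y) * ‖u x - u z‖ := by
          gcongr
          linarith [ha0 x]
      _ = ‖-(gradConv W ρ x - gradConv W ρ z)
          + ∫ y, ((φ (x - y) - φ (z - y)) * ρ y) • (u y - u z)‖ := by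
          rw [← hxz, norm_smul, Real.norm_of_nonneg (add_nonneg hγ0.le (ha0 x))]
      _ ≤ KW₁ * ‖x - z‖ + Kφ₁ * ‖x - z‖ * (U + U) * Mρ := by
          refine (norm_add_le _ _).trans (add_le_add ?_ hI)
          rw [norm_neg]
          exact hWlip x z
      _ = (KW₁ + 2 * (Kφ₁ * Mρ * U)) * ‖x - z‖ := by ring
  have hgrad : ∀ x, ‖fderiv ℝ u x‖ ≤ (KW₁ + 2 * (Kφ₁ * Mρ * U)) / γ := fun x => by
    have hC : 0 ≤ (KW₁ + 2 * (Kφ₁ * Mρ * U)) / γ := by positivity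
    refine norm_fderiv_le_of_lip' ℝ hC (Eventually.of_forall fun z => ?_)
    rw [div_mul_eq_mul_div, le_div_iff₀ hγ0, mul_comm]
    exact hlip z x
  have hconst : (KW₁ + 2 * (Kφ₁ * Mρ * U)) / γ
      ≤ (1 + Kφ₁ * Mρ / γ) * (1 / γ) *
          ((KW₀ + KW₁) + Mρ * (Kφ₀ + Kφ₁) * KW₀ / (γ - Kφ₀ * Mρ)) := by
    rw [mul_div_assoc (Mρ * (Kφ₀ + Kφ₁)), ← hUdef]
    have hsum : KW₀ + KW₁ + Mρ * (Kφ₀ + Kφ₁) * U = γ * U + (KW₁ + Kφ₁ * Mρ * U) := by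
      rw [hUγ]
      ring
    have hrhs : (1 + Kφ₁ * Mρ / γ) * (1 / γ) * (γ * U + (KW₁ + Kφ₁ * Mρ * U))
        = (KW₁ + 2 * (Kφ₁ * Mρ * U)) / γ
          + (U + Kφ₁ * Mρ / γ * (1 / γ) * (KW₁ + Kφ₁ * Mρ * U)) := by
      field_simp
      ring
    rw [hsum, hrhs]
    exact le_add_of_nonneg_right (by positivity)
  exact ⟨fun x => (hgrad x).trans hconst, fun x => add_le_add (hU x) ((hgrad x).trans hconst)⟩
end
end
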